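/- Let b₀, …, bₙ : ℝ → Matrix (Fin r) (Fin r) ℝ, P : ℝ → Matrix (Fin r) (Fin m) ℝ and Q : ℝ → Matrix (Fin m) (Fin r) ℝ be smooth. Let B(g) = Σ_{i=0}^{n} b_i·g^{(i)} acting on W_r, let T : W_r → W_r be T(g) = P·I(Q·g), and set B(P) := Σ_{i=0}^{n} b_i·P^{(i)} and B*(Q) := Σ_{i=0}^{n} (-1)^i (Q·b_i)^{(i)}. Then there exist smooth c₀, …, c_{n-1} : ℝ → Matrix (Fin r) (Fin r) ℝ such that, as operators on W_r, B∘T - T∘B = M_{B(P)}∘I∘M_Q - M_P∘I∘M_{B*(Q)} + Σ_{i=0}^{n-1} M_{c_i}∘D^i. (This is the lemma [Bₙ^{(β,r)}, P^{(r)}∂⁻¹Q^{(r)}]₋ = Bₙ^{(β,r)}(P^{(r)})∂⁻¹Q^{(r)} - P^{(r)}∂⁻¹(Bₙ^{(β,r)})*(Q^{(r)}) for the constrained multi-component KP hierarchy.) -/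

import Mathlib

open MeasureTheory Finset

/-- A function `ℝ → A` has support bounded below. -/
def SuppBddBelowR {A : Type*} [Zero A] (f : ℝ → A) : Prop :=
  ∃ a : ℝ, ∀ x : ℝ, x ≤ a → f x = 0

/-- The integration operator applied componentwise to vector-valued functions. -/
noncomputable def IopV {p : ℕ} (f : ℝ → Fin p → ℝ) : ℝ → Fin p → ℝ :=
  fun x => ∫ y in Set.Iic x, f y

/-- The integration operator applied entrywise to matrix-valued functions. -/
noncomputable def matInt {p q : ℕ} (a : ℝ → Matrix (Fin p) (Fin q) ℝ) :
    ℝ → Matrix (Fin p) (Fin q) ℝ :=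
  fun x => Matrix.of fun i j => ∫ y in Set.Iic x, a y i j

/-- The `k`-th derivative applied entrywise to matrix-valued functions. -/
noncomputable def matIter {p q : ℕ} (k : ℕ) (a : ℝ → Matrix (Fin p) (Fin q) ℝ) :
    ℝ → Matrix (Fin p) (Fin q) ℝ :=
  fun x => Matrix.of fun i j => iteratedDeriv k (fun y => a y i j) x

/-- A matrix-valued function is smooth (entrywise `C^∞`). -/
def MatSmooth {p q : ℕ} (a : ℝ → Matrix (Fin p) (Fin q) ℝ) : Prop :=
  ∀ (i : Fin p) (j : Fin q), ContDiff ℝ (⊤ : ℕ∞) fun x => a x i j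

/-- The local differential operator `B(g) = Σ_{i=0}^{n} b_i·g⁽ⁱ⁾` acting on `W_r`. -/
noncomputable def Bop {r : ℕ} (n : ℕ) (b : ℕ → ℝ → Matrix (Fin r) (Fin r) ℝ)
    (g : ℝ → Fin r → ℝ) : ℝ → Fin r → ℝ :=
  fun x => ∑ i ∈ Finset.range (n + 1), (b i x).mulVec (iteratedDeriv i g x)

/-- The operator `T(g) = P·I(Q·g)` acting on `W_r`. -/
noncomputable def TTop {r m : ℕ} (P : ℝ → Matrix (Fin r) (Fin m) ℝ)
    (Q : ℝ → Matrix (Fin m) (Fin r) ℝ) (g : ℝ → Fin r → ℝ) : ℝ → Fin r → ℝ :=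
  fun x => (P x).mulVec (IopV (fun y => (Q y).mulVec (g y)) x)

theorem MatSmooth.matIter {p q : ℕ} {A : ℝ → Matrix (Fin p) (Fin q) ℝ} (hA : MatSmooth A) (k : ℕ) :
    MatSmooth (matIter k A) := by
  intro i j
  simp only [_root_.matIter, Matrix.of_apply]
  rw [iteratedDeriv_eq_iterate]
  exact (hA i j).iterate_deriv k

theorem MatSmooth.mul {p q s : ℕ} {A : ℝ → Matrix (Fin p) (Fin q) ℝ}
    {B : ℝ → Matrix (Fin q) (Fin s) ℝ} (hA : MatSmooth A) (hB : MatSmooth B) :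
    MatSmooth fun x => A x * B x := by
  intro i j
  simp only [Matrix.mul_apply]
  exact ContDiff.sum fun l _ => (hA i l).mul (hB l j)

theorem MatSmooth.add {p q : ℕ} {A B : ℝ → Matrix (Fin p) (Fin q) ℝ}
    (hA : MatSmooth A) (hB : MatSmooth B) : MatSmooth fun x => A x + B x :=
  fun i j => (hA i j).add (hB i j)

theorem MatSmooth.neg {p q : ℕ} {A : ℝ → Matrix (Fin p) (Fin q) ℝ} (hA : MatSmooth A) :
    MatSmooth fun x => -A x :=
  fun i j => (hA i j).neg

theorem MatSmooth.const_smul {p q : ℕ} {A : ℝ → Matrix (Fin p) (Fin q) ℝ} (hA : MatSmooth A)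
    (t : ℝ) : MatSmooth fun x => t • A x :=
  fun i j => contDiff_const.mul (hA i j)

theorem MatSmooth.zero {p q : ℕ} : MatSmooth fun _ => (0 : Matrix (Fin p) (Fin q) ℝ) :=
  fun _ _ => contDiff_const

theorem MatSmooth.contDiff_mulVec {p q : ℕ} {A : ℝ → Matrix (Fin p) (Fin q) ℝ} (hA : MatSmooth A)
    {v : ℝ → Fin q → ℝ} (hv : ContDiff ℝ (⊤ : ℕ∞) v) :
    ContDiff ℝ (⊤ : ℕ∞) fun x => (A x).mulVec (v x) := by
  rw [contDiff_pi] at hv ⊢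
  intro i
  simp only [Matrix.mulVec, dotProduct]
  exact ContDiff.sum fun l _ => (hA i l).mul (hv l)

theorem matIter_zero {p q : ℕ} (A : ℝ → Matrix (Fin p) (Fin q) ℝ) : matIter 0 A = A := by
  ext x i j
  simp [matIter]

theorem matIter_succ {p q : ℕ} (A : ℝ → Matrix (Fin p) (Fin q) ℝ) (k : ℕ) :
    matIter (k + 1) A = matIter 1 (matIter k A) := by
  ext x i j
  simp [matIter, iteratedDeriv_succ]

theorem matIter_succ' {p q : ℕ} (A : ℝ → Matrix (Fin p) (Fin q) ℝ) (k : ℕ) :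
    matIter (k + 1) A = matIter k (matIter 1 A) := by
  ext x i j
  simp only [matIter, iteratedDeriv_succ', Matrix.of_apply, iteratedDeriv_zero]

theorem MatSmooth.hasDerivAt_mulVec {p q : ℕ} {A : ℝ → Matrix (Fin p) (Fin q) ℝ}
    (hA : MatSmooth A) {v : ℝ → Fin q → ℝ} {v' : Fin q → ℝ} {x : ℝ} (hv : HasDerivAt v v' x) :
    HasDerivAt (fun y => (A y).mulVec (v y))
      ((_root_.matIter 1 A x).mulVec (v x) + (A x).mulVec v') x := by
  rw [hasDerivAt_pi] at hv ⊢
  intro i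
  simp only [Matrix.mulVec, dotProduct, Pi.add_apply, _root_.matIter, Matrix.of_apply,
    iteratedDeriv_one, ← Finset.sum_add_distrib]
  exact HasDerivAt.fun_sum fun l _ =>
    (((hA i l).differentiable (by simp)).differentiableAt.hasDerivAt).mul (hv l)

theorem contDiff_iteratedDeriv {p : ℕ} {g : ℝ → Fin p → ℝ} (hg : ContDiff ℝ (⊤ : ℕ∞) g) (k : ℕ) :
    ContDiff ℝ (⊤ : ℕ∞) (iteratedDeriv k g) := by
  rw [iteratedDeriv_eq_iterate]
  exact hg.iterate_deriv k

theorem hasDerivAt_iteratedDeriv {p : ℕ} {g : ℝ → Fin p → ℝ} (hg : ContDiff ℝ (⊤ : ℕ∞) g)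
    (k : ℕ) (x : ℝ) : HasDerivAt (iteratedDeriv k g) (iteratedDeriv (k + 1) g x) x := by
  rw [iteratedDeriv_succ]
  exact ((contDiff_iteratedDeriv hg k).differentiable (by simp)).differentiableAt.hasDerivAt

theorem SuppBddBelowR.deriv {p : ℕ} {g : ℝ → Fin p → ℝ} (hg : SuppBddBelowR g) :
    SuppBddBelowR (deriv g) := by
  obtain ⟨a, ha⟩ := hg
  refine ⟨a - 1, fun x hx => ?_⟩
  have : g =ᶠ[nhds x] fun _ => 0 := by
    filter_upwards [Iio_mem_nhds (show x < a by linarith)] with y hy using ha y hy.le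
  rw [this.deriv_eq]
  simp

theorem SuppBddBelowR.iteratedDeriv {p : ℕ} {g : ℝ → Fin p → ℝ} (hg : SuppBddBelowR g) (k : ℕ) :
    SuppBddBelowR (iteratedDeriv k g) := by
  induction k with
  | zero => simpa using hg
  | succ k ih =>
    rw [iteratedDeriv_succ]
    exact ih.deriv

theorem SuppBddBelowR.mulVec {p q : ℕ} (A : ℝ → Matrix (Fin p) (Fin q) ℝ) {g : ℝ → Fin q → ℝ}
    (hg : SuppBddBelowR g) : SuppBddBelowR fun x => (A x).mulVec (g x) := by
  obtain ⟨a, ha⟩ := hg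
  exact ⟨a, fun x hx => by simp [ha x hx]⟩

theorem SuppBddBelowR.integrableOn_Iic {p : ℕ} {f : ℝ → Fin p → ℝ} (hs : SuppBddBelowR f)
    (hf : Continuous f) (x : ℝ) : IntegrableOn f (Set.Iic x) := by
  obtain ⟨a, ha⟩ := hs
  have h₁ : IntegrableOn f (Set.Iic a) :=
    integrableOn_zero.congr_fun (fun y hy => (ha y hy).symm) measurableSet_Iic
  refine (h₁.union (hf.integrableOn_Icc (a := a) (b := x))).mono_set fun y hy => ?_
  rcases le_total y a with h | h
  · exact Or.inl h
  · exact Or.inr ⟨h, hy⟩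

theorem IopV_eq_intervalIntegral {p : ℕ} {f : ℝ → Fin p → ℝ} {a : ℝ} (ha : ∀ x ≤ a, f x = 0)
    (hf : Continuous f) (x : ℝ) : IopV f x = ∫ y in a..x, f y := by
  have hs : SuppBddBelowR f := ⟨a, ha⟩
  rw [← intervalIntegral.integral_Iic_sub_Iic (hs.integrableOn_Iic hf a) (hs.integrableOn_Iic hf x),
    setIntegral_eq_zero_of_forall_eq_zero (t := Set.Iic a) ha, sub_zero, IopV]

theorem hasDerivAt_IopV {p : ℕ} {f : ℝ → Fin p → ℝ} (hs : SuppBddBelowR f)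
    (hf : Continuous f) (x : ℝ) : HasDerivAt (IopV f) (f x) x := by
  obtain ⟨a, ha⟩ := hs
  rw [funext (IopV_eq_intervalIntegral ha hf)]
  exact hf.integral_hasStrictDerivAt a x |>.hasDerivAt

theorem IopV_eq_of_hasDerivAt {p : ℕ} {f f' : ℝ → Fin p → ℝ} (hs : SuppBddBelowR f)
    (hs' : SuppBddBelowR f') (hd : ∀ x, HasDerivAt f (f' x) x) (hf' : Continuous f') :
    IopV f' = f := by
  obtain ⟨a, ha⟩ := hs
  obtain ⟨b, hb⟩ := hs'
  funext x
  rw [IopV_eq_intervalIntegral (a := min a b) (fun y hy => hb y (hy.trans (min_le_right _ _))) hf',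
    intervalIntegral.integral_eq_sub_of_hasDerivAt (fun y _ => hd y)
      (hf'.intervalIntegrable _ _), ha _ (min_le_left _ _), sub_zero]

/-- Operators that agree on smooth functions with support bounded below with a local
differential operator of order less than `k` with smooth coefficients. -/
def IsLocalDiffOp {r p : ℕ} (k : ℕ) (F : (ℝ → Fin r → ℝ) → ℝ → Fin p → ℝ) : Prop :=
  ∃ c : ℕ → ℝ → Matrix (Fin p) (Fin r) ℝ, (∀ i, MatSmooth (c i)) ∧
    ∀ g : ℝ → Fin r → ℝ, ContDiff ℝ (⊤ : ℕ∞) g → SuppBddBelowR g → ∀ x : ℝ,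
      F g x = ∑ i ∈ Finset.range k, (c i x).mulVec (iteratedDeriv i g x)

namespace IsLocalDiffOp

variable {r p q k l : ℕ} {F G : (ℝ → Fin r → ℝ) → ℝ → Fin p → ℝ}

theorem congr (hF : IsLocalDiffOp k F)
    (h : ∀ g : ℝ → Fin r → ℝ, ContDiff ℝ (⊤ : ℕ∞) g → SuppBddBelowR g → ∀ x, G g x = F g x) :
    IsLocalDiffOp k G := by
  obtain ⟨c, hc, hF⟩ := hF
  exact ⟨c, hc, fun g hg hs x => (h g hg hs x).trans (hF g hg hs x)⟩

theorem zero : IsLocalDiffOp k (fun _ _ => 0 : (ℝ → Fin r → ℝ) → ℝ → Fin p → ℝ) :=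
  ⟨fun _ _ => 0, fun _ => MatSmooth.zero, fun g _ _ x => by simp⟩

theorem add (hF : IsLocalDiffOp k F) (hG : IsLocalDiffOp k G) :
    IsLocalDiffOp k fun g x => F g x + G g x := by
  obtain ⟨c, hc, hF⟩ := hF
  obtain ⟨d, hd, hG⟩ := hG
  refine ⟨fun i x => c i x + d i x, fun i => (hc i).add (hd i), fun g hg hs x => ?_⟩
  simp only [hF g hg hs x, hG g hg hs x, Matrix.add_mulVec, Finset.sum_add_distrib]

theorem neg (hF : IsLocalDiffOp k F) : IsLocalDiffOp k fun g x => -F g x := by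
  obtain ⟨c, hc, hF⟩ := hF
  refine ⟨fun i x => -c i x, fun i => (hc i).neg, fun g hg hs x => ?_⟩
  simp only [hF g hg hs x, Matrix.neg_mulVec, Finset.sum_neg_distrib]

theorem sum {ι : Type*} {s : Finset ι} {H : ι → (ℝ → Fin r → ℝ) → ℝ → Fin p → ℝ}
    (h : ∀ i ∈ s, IsLocalDiffOp k (H i)) : IsLocalDiffOp k fun g x => ∑ i ∈ s, H i g x := by
  classical
  induction s using Finset.induction_on with
  | empty => simpa using zero
  | insert a s ha ih =>
    simp only [Finset.sum_insert ha]
    exact (h a (by simp)).add (ih fun i hi => h i (by simp [hi]))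

theorem mulVec (hF : IsLocalDiffOp k F) {A : ℝ → Matrix (Fin q) (Fin p) ℝ} (hA : MatSmooth A) :
    IsLocalDiffOp k fun g x => (A x).mulVec (F g x) := by
  obtain ⟨c, hc, hF⟩ := hF
  refine ⟨fun i x => A x * c i x, fun i => hA.mul (hc i), fun g hg hs x => ?_⟩
  simp only [hF g hg hs x, Matrix.mulVec_sum, Matrix.mulVec_mulVec]

theorem monomial {A : ℝ → Matrix (Fin p) (Fin r) ℝ} (hA : MatSmooth A) {i : ℕ} (hi : i < k) :
    IsLocalDiffOp k fun g x => (A x).mulVec (iteratedDeriv i g x) := by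
  refine ⟨fun j x => if j = i then A x else 0, fun j => ?_, fun g _ _ x => ?_⟩
  · by_cases h : j = i
    · simpa [h] using hA
    · simpa [h] using MatSmooth.zero
  · rw [Finset.sum_eq_single_of_mem i (Finset.mem_range.2 hi) fun j _ hj => by simp [hj]]
    simp

theorem mono (hF : IsLocalDiffOp k F) (hkl : k ≤ l) : IsLocalDiffOp l F := by
  obtain ⟨c, hc, hF⟩ := hF
  exact (sum fun i hi => monomial (hc i) ((Finset.mem_range.1 hi).trans_le hkl)).congr hF

theorem hasDerivAt (hF : IsLocalDiffOp k F) :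
    ∃ F' : (ℝ → Fin r → ℝ) → ℝ → Fin p → ℝ, IsLocalDiffOp (k + 1) F' ∧
      ∀ g : ℝ → Fin r → ℝ, ContDiff ℝ (⊤ : ℕ∞) g → SuppBddBelowR g →
        ∀ x, HasDerivAt (F g) (F' g x) x := by
  obtain ⟨c, hc, hF⟩ := hF
  refine ⟨fun g x => ∑ i ∈ Finset.range k, ((matIter 1 (c i) x).mulVec (iteratedDeriv i g x)
      + (c i x).mulVec (iteratedDeriv (i + 1) g x)), ?_, fun g hg hs x => ?_⟩
  · refine sum fun i hi => ?_
    have hi := Finset.mem_range.1 hi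
    exact (monomial ((hc i).matIter 1) (by lia)).add (monomial (hc i) (by lia))
  · rw [funext (hF g hg hs)]
    exact HasDerivAt.fun_sum fun i _ => (hc i).hasDerivAt_mulVec (hasDerivAt_iteratedDeriv hg i x)

end IsLocalDiffOp

/-- The `k`-th derivative of `P·I(Q·g)` is `P⁽ᵏ⁾·I(Q·g)` up to a local operator of order
less than `k`. -/
theorem iteratedDeriv_TTop {r p m : ℕ} {P : ℝ → Matrix (Fin p) (Fin m) ℝ}
    {Q : ℝ → Matrix (Fin m) (Fin r) ℝ} (hP : MatSmooth P) (hQ : MatSmooth Q) (k : ℕ) :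
    ∃ L : (ℝ → Fin r → ℝ) → ℝ → Fin p → ℝ, IsLocalDiffOp k L ∧
      ∀ g : ℝ → Fin r → ℝ, ContDiff ℝ (⊤ : ℕ∞) g → SuppBddBelowR g → ∀ x,
        iteratedDeriv k (fun x => (P x).mulVec (IopV (fun y => (Q y).mulVec (g y)) x)) x
          = (matIter k P x).mulVec (IopV (fun y => (Q y).mulVec (g y)) x) + L g x := by
  induction k with
  | zero => exact ⟨fun _ _ => 0, IsLocalDiffOp.zero, fun g _ _ x => by simp [matIter_zero]⟩
  | succ k ih =>
    obtain ⟨L, hL, h⟩ := ih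
    obtain ⟨L', hL', hd⟩ := hL.hasDerivAt
    refine ⟨fun g x => (matIter k P x * Q x).mulVec (iteratedDeriv 0 g x) + L' g x,
      (IsLocalDiffOp.monomial ((hP.matIter k).mul hQ) (Nat.succ_pos k)).add hL',
      fun g hg hs x => ?_⟩
    rw [iteratedDeriv_succ, funext (h g hg hs), matIter_succ]
    simp only [iteratedDeriv_zero, ← Matrix.mulVec_mulVec, ← add_assoc]
    exact (((hP.matIter k).hasDerivAt_mulVec (hasDerivAt_IopV (hs.mulVec Q)
      (hQ.contDiff_mulVec hg).continuous x)).add (hd g hg hs x)).deriv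

/-- Repeated integration by parts: `I(A·g⁽ᵏ⁾)` is `(-1)ᵏ I(A⁽ᵏ⁾·g)` up to a local operator of
order less than `k`. -/
theorem IopV_mulVec_iteratedDeriv {r m : ℕ} (k : ℕ) {A : ℝ → Matrix (Fin m) (Fin r) ℝ}
    (hA : MatSmooth A) :
    ∃ L : (ℝ → Fin r → ℝ) → ℝ → Fin m → ℝ, IsLocalDiffOp k L ∧
      ∀ g : ℝ → Fin r → ℝ, ContDiff ℝ (⊤ : ℕ∞) g → SuppBddBelowR g → ∀ x,
        IopV (fun y => (A y).mulVec (iteratedDeriv k g y)) x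
          = IopV (fun y => (((-1 : ℝ) ^ k) • matIter k A y).mulVec (g y)) x + L g x := by
  induction k generalizing A with
  | zero => exact ⟨fun _ _ => 0, IsLocalDiffOp.zero, fun g _ _ x => by simp [matIter_zero]⟩
  | succ k ih =>
    obtain ⟨L, hL, h⟩ := ih (hA.matIter 1)
    refine ⟨fun g x => (A x).mulVec (iteratedDeriv k g x) + -L g x,
      (IsLocalDiffOp.monomial hA k.lt_succ_self).add (hL.mono k.le_succ).neg,
      fun g hg hs x => ?_⟩
    have hsk := hs.iteratedDeriv k
    have hs₁ := hsk.mulVec (matIter 1 A)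
    have hs₂ := (hs.iteratedDeriv (k + 1)).mulVec A
    have hc₁ := ((hA.matIter 1).contDiff_mulVec (contDiff_iteratedDeriv hg k)).continuous
    have hc₂ := (hA.contDiff_mulVec (contDiff_iteratedDeriv hg (k + 1))).continuous
    have hparts : IopV (fun y => (matIter 1 A y).mulVec (iteratedDeriv k g y)) x
        + IopV (fun y => (A y).mulVec (iteratedDeriv (k + 1) g y)) x
        = (A x).mulVec (iteratedDeriv k g x) := by
      have hsum : SuppBddBelowR fun y => (matIter 1 A y).mulVec (iteratedDeriv k g y)
          + (A y).mulVec (iteratedDeriv (k + 1) g y) := by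
        obtain ⟨a, ha⟩ := hs₁
        obtain ⟨b, hb⟩ := hs₂
        refine ⟨min a b, fun y hy => ?_⟩
        have h₁ := ha y (hy.trans (min_le_left _ _))
        have h₂ := hb y (hy.trans (min_le_right _ _))
        dsimp only at h₁ h₂ ⊢
        rw [h₁, h₂, add_zero]
      rw [← congrFun (IopV_eq_of_hasDerivAt (hsk.mulVec A) hsum
        (fun y => hA.hasDerivAt_mulVec (hasDerivAt_iteratedDeriv hg k y)) (hc₁.add hc₂)) x]
      exact (integral_add (hs₁.integrableOn_Iic hc₁ x) (hs₂.integrableOn_Iic hc₂ x)).symm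
    have hneg : IopV (fun y => (((-1 : ℝ) ^ (k + 1)) • matIter (k + 1) A y).mulVec (g y)) x
        = -IopV (fun y => (((-1 : ℝ) ^ k) • matIter k (matIter 1 A) y).mulVec (g y)) x := by
      simp only [IopV, ← integral_neg, matIter_succ' A k, pow_succ, mul_neg_one, neg_smul,
        Matrix.neg_mulVec]
    rw [hneg, eq_sub_of_add_eq' hparts, h g hg hs x]
    beta_reduce
    abel

theorem IopV_sum {p : ℕ} {ι : Type*} {s : Finset ι} {f : ι → ℝ → Fin p → ℝ}
    (hs : ∀ i ∈ s, SuppBddBelowR (f i)) (hf : ∀ i ∈ s, Continuous (f i)) (x : ℝ) :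
    IopV (fun y => ∑ i ∈ s, f i y) x = ∑ i ∈ s, IopV (f i) x :=
  integral_finsetSum s fun i hi => (hs i hi).integrableOn_Iic (hf i hi) x

/-- there exist smooth `c₀,…,c_{n-1}` such that, as operators on `W_r`,
`B∘T - T∘B = M_{B(P)}∘I∘M_Q - M_P∘I∘M_{B*(Q)} + Σ_{i=0}^{n-1} M_{c_i}∘Dⁱ`, where
`B(P) = Σ b_i·P⁽ⁱ⁾` and `B*(Q) = Σ (-1)ⁱ(Q·b_i)⁽ⁱ⁾`. -/
theorem stmt15 {r m n : ℕ} (b : ℕ → ℝ → Matrix (Fin r) (Fin r) ℝ)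
    (P : ℝ → Matrix (Fin r) (Fin m) ℝ) (Q : ℝ → Matrix (Fin m) (Fin r) ℝ)
    (hb : ∀ i, MatSmooth (b i)) (hP : MatSmooth P) (hQ : MatSmooth Q) :
    ∃ c : ℕ → ℝ → Matrix (Fin r) (Fin r) ℝ,
      (∀ i, MatSmooth (c i)) ∧
      ∀ g : ℝ → Fin r → ℝ, ContDiff ℝ (⊤ : ℕ∞) g → SuppBddBelowR g → ∀ x : ℝ,
        Bop n b (TTop P Q g) x - TTop P Q (Bop n b g) x
          = ((∑ i ∈ Finset.range (n + 1), b i x * matIter i P x)).mulVec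
              (IopV (fun y => (Q y).mulVec (g y)) x)
            - (P x).mulVec
                (IopV (fun y =>
                  ((∑ i ∈ Finset.range (n + 1),
                    ((-1 : ℝ) ^ i) • matIter i (fun z => Q z * b i z) y)).mulVec (g y)) x)
            + ∑ i ∈ Finset.range n, (c i x).mulVec (iteratedDeriv i g x) := by
  choose L hL hLeq using iteratedDeriv_TTop hP hQ
  choose K hK hKeq using fun i => IopV_mulVec_iteratedDeriv i (hQ.mul (hb i))
  have hlocal : IsLocalDiffOp n fun g x => ∑ i ∈ Finset.range (n + 1),
      ((b i x).mulVec (L i g x) + -(P x).mulVec (K i g x)) := by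
    refine IsLocalDiffOp.sum fun i hi => ?_
    have hi : i ≤ n := Nat.le_of_lt_succ (Finset.mem_range.1 hi)
    exact (((hL i).mono hi).mulVec (hb i)).add (((hK i).mono hi).mulVec hP).neg
  obtain ⟨c, hc, h⟩ := hlocal
  refine ⟨c, hc, fun g hg hs x => ?_⟩
  have hBT : Bop n b (TTop P Q g) x = ∑ i ∈ Finset.range (n + 1),
      ((b i x * matIter i P x).mulVec (IopV (fun y => (Q y).mulVec (g y)) x)
        + (b i x).mulVec (L i g x)) := by
    refine Finset.sum_congr rfl fun i _ => ?_
    rw [← Matrix.mulVec_mulVec, ← Matrix.mulVec_add, ← hLeq i g hg hs x]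
    rfl
  have hTB : TTop P Q (Bop n b g) x = ∑ i ∈ Finset.range (n + 1),
      ((P x).mulVec (IopV (fun y =>
        (((-1 : ℝ) ^ i) • matIter i (fun z => Q z * b i z) y).mulVec (g y)) x)
        + (P x).mulVec (K i g x)) := by
    simp only [TTop, Bop, Matrix.mulVec_sum, Matrix.mulVec_mulVec]
    rw [IopV_sum (fun i _ => (hs.iteratedDeriv i).mulVec _) fun i _ =>
      ((hQ.mul (hb i)).contDiff_mulVec (contDiff_iteratedDeriv hg i)).continuous,
      Matrix.mulVec_sum]
    exact Finset.sum_congr rfl fun i _ => by rw [hKeq i g hg hs x, Matrix.mulVec_add]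
  rw [← h g hg hs x, hBT, hTB]
  simp only [Matrix.sum_mulVec]
  rw [IopV_sum (fun i _ => hs.mulVec _) fun i _ =>
    ((((hQ.mul (hb i)).matIter i).const_smul _).contDiff_mulVec hg).continuous]
  simp only [Matrix.mulVec_sum, Finset.sum_add_distrib, Finset.sum_neg_distrib]
  abel
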